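/- Let a ∈ (0,1) and μ = (1-a)/(1+a). Then Σ_{n≥0} ‖φ_n‖_a² wⁿ = (1-a)^{-1/2} (1-w)^{-1/2} (1 - w/μ)^{-1/2} for |w| < μ, where ‖φ_n‖_a² = ∫_ℝ φ_n(x)² e^{a x²} dx/√(2π) and φ_n are the normalized Hermite functions. -/

import Mathlib

open Real MeasureTheory

/-- Physicists' Hermite polynomials, as functions. -/
noncomputable def physHermiteFun : ℕ → ℝ → ℝ
  | 0, _ => 1
  | 1, x => 2 * x
  | (n + 2), x => 2 * x * physHermiteFun (n + 1) x - 2 * (n + 1) * physHermiteFun n x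

/-- Hermite functions, normalized with respect to the measure dx/√(2π). -/
noncomputable def hermiteFun (n : ℕ) (x : ℝ) : ℝ :=
  (2 * π) ^ ((1 : ℝ) / 4) * (Real.sqrt (2 ^ n * Nat.factorial n * Real.sqrt π))⁻¹
    * physHermiteFun n x * Real.exp (-x ^ 2 / 2)

/-- The weighted squared norm ‖φₙ‖ₐ² = ∫ φₙ(x)² e^{ax²} dx/√(2π). -/
noncomputable def hermiteNormSq (a : ℝ) (n : ℕ) : ℝ :=
  (∫ x : ℝ, (hermiteFun n x) ^ 2 * Real.exp (a * x ^ 2)) / Real.sqrt (2 * π)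

theorem H_poly (n : ℕ) : ∃ P : Polynomial ℝ, ∀ x, physHermiteFun n x = P.eval x := by
  induction n using Nat.twoStepInduction with
  | zero => exact ⟨1, fun x => by simp [physHermiteFun]⟩
  | one => exact ⟨2 * Polynomial.X, fun x => by simp [physHermiteFun]⟩
  | more n h1 h2 =>
    obtain ⟨P, hP⟩ := h1
    obtain ⟨Q, hQ⟩ := h2
    exact ⟨2 * Polynomial.X * Q - Polynomial.C (2 * ((n : ℝ) + 1)) * P, fun x => by
      rw [physHermiteFun, hP, hQ]; simp⟩

theorem H_deriv (n : ℕ) (x : ℝ) :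
    HasDerivAt (physHermiteFun n) (2 * x * physHermiteFun n x - physHermiteFun (n + 1) x) x ∧
    HasDerivAt (physHermiteFun (n + 1)) (2 * (n + 1) * physHermiteFun n x) x := by
  induction n with
  | zero =>
    constructor
    · have : physHermiteFun 0 = fun _ => (1 : ℝ) := by ext; simp [physHermiteFun]
      rw [this]
      simpa [physHermiteFun] using hasDerivAt_const x (1 : ℝ)
    · have : physHermiteFun (0 + 1) = fun y => 2 * y := by ext; simp [physHermiteFun]
      rw [this]
      simpa [physHermiteFun] using (hasDerivAt_id x).const_mul (2 : ℝ)
  | succ n ih =>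
    have e : physHermiteFun (n + 1 + 1)
        = fun x => 2 * x * physHermiteFun (n + 1) x - 2 * (n + 1) * physHermiteFun n x := by
      ext y; rw [physHermiteFun]
    constructor
    · convert ih.2 using 1
      rw [e]; ring
    · rw [e]
      have := (((hasDerivAt_id' x).const_mul (2 : ℝ)).mul ih.2).sub
        (ih.1.const_mul (2 * ((n : ℝ) + 1)))
      refine this.congr_deriv ?_
      push_cast; ring

theorem poly_int (P : Polynomial ℝ) {b : ℝ} (hb : 0 < b) :
    Integrable (fun x : ℝ => P.eval x * exp (-b * x ^ 2)) := by
  induction P using Polynomial.induction_on' with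
  | add p q hp hq =>
    refine (hp.add hq).congr (Filter.Eventually.of_forall fun x => ?_)
    simp [add_mul]
  | monomial n c =>
    have h := (integrable_rpow_mul_exp_neg_mul_sq hb (s := (n : ℝ))
      (by have := Nat.cast_nonneg (α := ℝ) n; linarith)).const_mul c
    refine h.congr (Filter.Eventually.of_forall fun x => ?_)
    simp [Polynomial.eval_monomial, mul_assoc]

noncomputable def In (b : ℝ) (n : ℕ) : ℝ := ∫ x : ℝ, physHermiteFun n x ^ 2 * exp (-b * x ^ 2)
noncomputable def Kn (b : ℝ) (n : ℕ) : ℝ :=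
  ∫ x : ℝ, x * physHermiteFun n x * physHermiteFun (n + 1) x * exp (-b * x ^ 2)

theorem intI {b : ℝ} (hb : 0 < b) (n : ℕ) :
    Integrable (fun x : ℝ => physHermiteFun n x ^ 2 * exp (-b * x ^ 2)) := by
  obtain ⟨P, hP⟩ := H_poly n
  refine (poly_int (P ^ 2) hb).congr (Filter.Eventually.of_forall fun x => ?_)
  simp [hP]

theorem intK {b : ℝ} (hb : 0 < b) (n : ℕ) :
    Integrable (fun x : ℝ =>
      x * physHermiteFun n x * physHermiteFun (n + 1) x * exp (-b * x ^ 2)) := by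
  obtain ⟨P, hP⟩ := H_poly n
  obtain ⟨Q, hQ⟩ := H_poly (n + 1)
  refine (poly_int (Polynomial.X * P * Q) hb).congr (Filter.Eventually.of_forall fun x => ?_)
  simp [hP, hQ]

theorem intHH {b : ℝ} (hb : 0 < b) (n : ℕ) :
    Integrable (fun x : ℝ =>
      physHermiteFun (n + 1) x * physHermiteFun n x * exp (-b * x ^ 2)) := by
  obtain ⟨P, hP⟩ := H_poly n
  obtain ⟨Q, hQ⟩ := H_poly (n + 1)
  refine (poly_int (Q * P) hb).congr (Filter.Eventually.of_forall fun x => ?_)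
  simp [hP, hQ]

theorem rel1 {b : ℝ} (hb : 0 < b) (n : ℕ) :
    2 * (n + 1) * In b n - In b (n + 1) + 2 * (1 - b) * Kn b n = 0 := by
  have hd : ∀ x : ℝ, HasDerivAt
      (fun x : ℝ => physHermiteFun (n + 1) x * physHermiteFun n x * exp (-b * x ^ 2))
      (2 * (n + 1) * (physHermiteFun n x ^ 2 * exp (-b * x ^ 2))
        - physHermiteFun (n + 1) x ^ 2 * exp (-b * x ^ 2)
        + 2 * (1 - b) * (x * physHermiteFun n x * physHermiteFun (n + 1) x * exp (-b * x ^ 2)))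
      x := by
    intro x
    have h1 := ((hasDerivAt_pow 2 x).const_mul (-b)).exp
    have h2 := ((H_deriv n x).2.mul (H_deriv n x).1).mul h1
    refine h2.congr_deriv ?_
    simp only [Pi.mul_apply]
    push_cast
    ring
  have i1 := (intI hb n).const_mul (2 * ((n : ℝ) + 1))
  have i2 := intI hb (n + 1)
  have i3 := (intK hb n).const_mul (2 * (1 - b))
  have i12 : Integrable (fun x : ℝ => 2 * ((n : ℝ) + 1) * (physHermiteFun n x ^ 2 * exp (-b * x ^ 2))
      - physHermiteFun (n + 1) x ^ 2 * exp (-b * x ^ 2)) := i1.sub i2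
  have h := integral_eq_zero_of_hasDerivAt_of_integrable hd (i12.add i3) (intHH hb n)
  rw [integral_add i12 i3, integral_sub i1 i2, integral_const_mul,
    integral_const_mul] at h
  exact h

theorem rel2 {b : ℝ} (hb : 0 < b) (n : ℕ) :
    2 * Kn b (n + 1) = In b (n + 2) + (4 * (n + 1) * Kn b n - 4 * (n + 1) ^ 2 * In b n) := by
  have i1 := intI hb (n + 2)
  have i2 := (intK hb n).const_mul (4 * ((n : ℝ) + 1))
  have i3 := (intI hb n).const_mul (4 * ((n : ℝ) + 1) ^ 2)
  have i23 : Integrable (fun x : ℝ => 4 * ((n : ℝ) + 1) *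
      (x * physHermiteFun n x * physHermiteFun (n + 1) x * exp (-b * x ^ 2))
      - 4 * ((n : ℝ) + 1) ^ 2 * (physHermiteFun n x ^ 2 * exp (-b * x ^ 2))) := i2.sub i3
  unfold In Kn
  rw [← integral_const_mul, ← integral_const_mul, ← integral_const_mul, ← integral_sub i2 i3,
    ← integral_add i1 i23]
  congr 1
  ext x
  rw [show n + 1 + 1 = n + 2 from rfl, physHermiteFun]
  ring

theorem c_eq (a : ℝ) (n : ℕ) :
    hermiteNormSq a n = In (1 - a) n / (√π * (2 ^ n * n.factorial)) := by
  have hpi := pi_pos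
  have h4 : ((2 * π) ^ ((1 : ℝ) / 4)) ^ 2 = √(2 * π) := by
    rw [← rpow_natCast, ← rpow_mul (by positivity), sqrt_eq_rpow]; norm_num
  have : ∀ x : ℝ, (hermiteFun n x) ^ 2 * exp (a * x ^ 2) =
      (√(2 * π) * (2 ^ n * n.factorial * √π)⁻¹) *
        (physHermiteFun n x ^ 2 * exp (-(1 - a) * x ^ 2)) := by
    intro x
    have e : exp (-(1 - a) * x ^ 2) = exp (-x ^ 2 / 2) ^ 2 * exp (a * x ^ 2) := by
      rw [← exp_nat_mul, ← exp_add]; congr 1; push_cast; ring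
    rw [hermiteFun, mul_pow, mul_pow, mul_pow, h4, inv_pow, sq_sqrt (by positivity), e]
    ring
  unfold hermiteNormSq In
  simp_rw [this]
  rw [integral_const_mul]
  have : √(2 * π) ≠ 0 := by positivity
  field_simp

theorem c_rec {a : ℝ} (ha0 : 0 < a) (ha1 : a < 1) (n : ℕ) :
    (1 - a) * (n + 2) * hermiteNormSq a (n + 2)
      = (2 * n + 3) * hermiteNormSq a (n + 1) - (n + 1) * (1 + a) * hermiteNormSq a n := by
  have hb : 0 < 1 - a := by linarith
  have r1 := rel1 hb n
  have r2 := rel1 hb (n + 1)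
  have r3 := rel2 hb n
  rw [c_eq, c_eq, c_eq]
  have hpi : √π ≠ 0 := by have := pi_pos; positivity
  have hI : (1 - a) * In (1 - a) (n + 2) = (4 * n + 6) * In (1 - a) (n + 1)
      - 4 * (n + 1) ^ 2 * (1 + a) * In (1 - a) n := by
    push_cast at r2
    linear_combination 2 * (n + 1) * r1 - r2 + a * r3
  simp only [Nat.factorial_succ, pow_succ]
  push_cast
  field_simp
  linear_combination (n + 2) * hI

theorem c_one {a : ℝ} (_ha0 : 0 < a) (ha1 : a < 1) :
    (1 - a) * hermiteNormSq a 1 = hermiteNormSq a 0 := by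
  have hb : 0 < 1 - a := by linarith
  have r1 := rel1 hb 0
  have hK : 2 * Kn (1 - a) 0 = In (1 - a) 1 := by
    unfold In Kn
    rw [← integral_const_mul]
    congr 1; ext x; simp [physHermiteFun]; ring
  rw [c_eq, c_eq]
  have hpi : √π ≠ 0 := by have := pi_pos; positivity
  simp at r1 ⊢
  field_simp
  linear_combination a * hK - r1

theorem c_zero {a : ℝ} (ha1 : a < 1) : hermiteNormSq a 0 = (√(1 - a))⁻¹ := by
  have hb : 0 < 1 - a := by linarith
  rw [c_eq]
  have : In (1 - a) 0 = √(π / (1 - a)) := by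
    rw [← integral_gaussian]; simp [In, physHermiteFun]
  have hpi : √π ≠ 0 := by have := pi_pos; positivity
  rw [this, sqrt_div pi_pos.le]
  simp
  field_simp

theorem c_nonneg (a : ℝ) (n : ℕ) : 0 ≤ hermiteNormSq a n := by
  unfold hermiteNormSq
  exact div_nonneg (integral_nonneg fun x => by positivity) (sqrt_nonneg _)

theorem c_anti {a : ℝ} (ha0 : 0 < a) (ha1 : a < 1) (n : ℕ) :
    (1 - a) * hermiteNormSq a (n + 1) ≤ (1 + a) * hermiteNormSq a n := by
  induction n with
  | zero =>
    have := c_nonneg a 0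
    rw [zero_add, c_one ha0 ha1]
    nlinarith
  | succ n ih =>
    have r := c_rec ha0 ha1 n
    have h0 := c_nonneg a (n + 1)
    have hn : (0 : ℝ) < n + 2 := by positivity
    have hn1 : (0 : ℝ) ≤ n + 1 := by positivity
    have h1 := mul_le_mul_of_nonneg_left ih hn1
    have h2 := mul_nonneg ha0.le h0
    rw [show n + 1 + 1 = n + 2 from rfl]
    refine le_of_mul_le_mul_left ?_ hn
    nlinarith

theorem c_bound {a : ℝ} (ha0 : 0 < a) (ha1 : a < 1) {μ : ℝ} (hμ : μ = (1 - a) / (1 + a))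
    (n : ℕ) : hermiteNormSq a n * μ ^ n ≤ hermiteNormSq a 0 := by
  have hμ0 : 0 < μ := by rw [hμ]; exact div_pos (by linarith) (by linarith)
  induction n with
  | zero => simp
  | succ n ih =>
    refine le_trans ?_ ih
    have h := c_anti ha0 ha1 n
    have : hermiteNormSq a (n + 1) * μ ≤ hermiteNormSq a n := by
      rw [hμ, mul_div_assoc', div_le_iff₀ (by linarith)]; linarith
    calc _ = hermiteNormSq a (n + 1) * μ * μ ^ n := by ring
      _ ≤ _ := by gcongr

theorem c_sum {a : ℝ} (ha0 : 0 < a) (ha1 : a < 1) {μ : ℝ} (hμ : μ = (1 - a) / (1 + a))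
    {r : ℝ} (hr0 : 0 ≤ r) (hr : r < μ) (k : ℕ) :
    Summable (fun n : ℕ => (n : ℝ) ^ k * (hermiteNormSq a n * r ^ n)) := by
  have hμ0 : 0 < μ := by rw [hμ]; exact div_pos (by linarith) (by linarith)
  have hq : ‖r / μ‖ < 1 := by
    rw [Real.norm_of_nonneg (by positivity), div_lt_one hμ0]; exact hr
  have h := (summable_pow_mul_geometric_of_norm_lt_one k hq).mul_left (hermiteNormSq a 0)
  refine Summable.of_nonneg_of_le (fun n => ?_) (fun n => ?_) h
  · have := c_nonneg a n
    positivity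
  · have h1 := c_bound ha0 ha1 hμ n
    have : hermiteNormSq a n * r ^ n = hermiteNormSq a n * μ ^ n * (r / μ) ^ n := by
      rw [div_pow]; field_simp
    rw [this]
    calc _ = (n : ℝ) ^ k * (r / μ) ^ n * (hermiteNormSq a n * μ ^ n) := by ring
      _ ≤ (n : ℝ) ^ k * (r / μ) ^ n * hermiteNormSq a 0 := by gcongr
      _ = _ := by ring

theorem F_deriv {a : ℝ} (ha0 : 0 < a) (ha1 : a < 1) {μ : ℝ} (hμ : μ = (1 - a) / (1 + a))
    {y : ℝ} (hy : |y| < μ) :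
    ∃ D, HasDerivAt (fun z => ∑' n : ℕ, hermiteNormSq a n * z ^ n) D y ∧
      (1 - y) * (1 - a - (1 + a) * y) * D
        = (1 - (1 + a) * y) * ∑' n : ℕ, hermiteNormSq a n * y ^ n := by
  obtain ⟨r, hyr, hrμ⟩ := exists_between hy
  have hr0 : 0 < r := lt_of_le_of_lt (abs_nonneg y) hyr
  have hu : Summable (fun n : ℕ => hermiteNormSq a n * (n * r ^ (n - 1))) := by
    refine ((c_sum ha0 ha1 hμ hr0.le hrμ 1).mul_left r⁻¹).congr fun n => ?_
    rcases n with _ | n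
    · simp
    · simp only [pow_one, Nat.add_sub_cancel, pow_succ r n]
      field_simp
  have hbd : ∀ n : ℕ, ∀ z ∈ Set.Ioo (-r) r,
      ‖hermiteNormSq a n * (n * z ^ (n - 1))‖ ≤ hermiteNormSq a n * (n * r ^ (n - 1)) := by
    intro n z hz
    have hz' : |z| ≤ r := abs_le.2 ⟨hz.1.le, hz.2.le⟩
    have := c_nonneg a n
    rw [norm_mul, norm_mul, norm_pow, Real.norm_of_nonneg this,
      Real.norm_of_nonneg (Nat.cast_nonneg n), Real.norm_eq_abs]
    gcongr
  have hyI : y ∈ Set.Ioo (-r) r := abs_lt.1 hyr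
  have s1 : Summable (fun n : ℕ => hermiteNormSq a n * (n * y ^ (n - 1))) :=
    Summable.of_norm_bounded hu fun n => hbd n y hyI
  have s0 : Summable (fun n : ℕ => hermiteNormSq a n * y ^ n) := by
    refine Summable.of_norm_bounded (c_sum ha0 ha1 hμ hr0.le hrμ 0) fun n => ?_
    have := c_nonneg a n
    rw [norm_mul, norm_pow, Real.norm_of_nonneg this, Real.norm_eq_abs, pow_zero, one_mul]
    gcongr
  refine ⟨∑' n : ℕ, hermiteNormSq a n * (n * y ^ (n - 1)), ?_, ?_⟩
  · refine hasDerivAt_tsum_of_isPreconnected hu isOpen_Ioo isPreconnected_Ioo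
      (fun n z _ => ?_) hbd hyI s0 hyI
    exact (hasDerivAt_pow n z).const_mul _
  · set D := ∑' n : ℕ, hermiteNormSq a n * (n * y ^ (n - 1)) with hD
    set F := ∑' n : ℕ, hermiteNormSq a n * y ^ n with hF
    have h0 : HasSum (fun n : ℕ => hermiteNormSq a n * y ^ n) F := s0.hasSum
    have h1 : HasSum (fun n : ℕ => hermiteNormSq a n * (n * y ^ (n - 1))) D := s1.hasSum
    have h1y : HasSum (fun n : ℕ => hermiteNormSq a n * (n * y ^ n)) (y * D) := by
      refine (h1.mul_left y).congr_fun ?_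
      intro n
      rcases n with _ | n
      · simp
      · simp only [Nat.add_sub_cancel]; ring
    have e2 := (hasSum_nat_add_iff' 2).2 h1
    have e1 := (hasSum_nat_add_iff' 1).2 ((h1y.mul_left 2).add h0)
    have e0 := (h1y.add h0).mul_left ((1 + a) * y)
    have hL := e2.mul_left (1 - a)
    have hR := e1.sub e0
    have := hL.unique (hR.congr_fun fun n => ?_)
    · simp [Finset.sum_range_succ] at this
      have c1 := c_one ha0 ha1
      linear_combination this + c1
    · have r := c_rec ha0 ha1 n
      simp only [Nat.add_sub_cancel, show n + 2 - 1 = n + 1 from rfl]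
      push_cast
      linear_combination y ^ (n + 1) * r

theorem main' {a : ℝ} (ha0 : 0 < a) (ha1 : a < 1) {μ : ℝ} (hμ : μ = (1 - a) / (1 + a))
    {w : ℝ} (hw : |w| < μ) :
    √((1 - w) * (1 - a - (1 + a) * w)) * ∑' n : ℕ, hermiteNormSq a n * w ^ n = 1 := by
  have hμ0 : 0 < μ := by rw [hμ]; exact div_pos (by linarith) (by linarith)
  have hQ : ∀ y ∈ Set.Ioo (-μ) μ, 0 < (1 - y) * (1 - a - (1 + a) * y) := by
    intro y hy
    have h1 : y < μ := hy.2
    have h2 : μ < 1 := by rw [hμ, div_lt_one (by linarith)]; linarith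
    rw [hμ, lt_div_iff₀ (by linarith)] at h1
    exact mul_pos (by linarith [hy.2]) (by linarith)
  have hd : ∀ y ∈ Set.Ioo (-μ) μ, HasDerivAt (fun w => √((1 - w) * (1 - a - (1 + a) * w)) *
      ∑' n : ℕ, hermiteNormSq a n * w ^ n) 0 y := by
    intro y hy
    obtain ⟨D, hD, hE⟩ := F_deriv ha0 ha1 hμ (abs_lt.2 hy)
    have q := hQ y hy
    have hq : HasDerivAt (fun w => (1 - w) * (1 - a - (1 + a) * w)) (-2 + 2 * (1 + a) * y) y := by
      refine (((hasDerivAt_id' y).const_sub 1).mul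
        (((hasDerivAt_id' y).const_mul (1 + a)).const_sub (1 - a))).congr_deriv ?_
      ring
    refine ((hq.sqrt q.ne').mul hD).congr_deriv ?_
    have hs : √((1 - y) * (1 - a - (1 + a) * y)) ≠ 0 := (sqrt_pos.2 q).ne'
    have hss := sq_sqrt q.le
    set F := ∑' n : ℕ, hermiteNormSq a n * y ^ n
    set S := √((1 - y) * (1 - a - (1 + a) * y))
    rw [← hss] at hE
    field_simp
    linear_combination hE
  have := isOpen_Ioo.is_const_of_deriv_eq_zero isPreconnected_Ioo
    (fun y hy => (hd y hy).differentiableAt.differentiableWithinAt)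
    (fun y hy => (hd y hy).deriv) (abs_lt.1 hw) (show (0 : ℝ) ∈ Set.Ioo (-μ) μ by simp [hμ0])

  rw [this, tsum_eq_single 0 (fun n hn => by simp [hn]), c_zero ha1]
  have : √(1 - a) ≠ 0 := (sqrt_pos.2 (by linarith)).ne'
  simp [this]

theorem hermite_norm_generating_function (a : ℝ) (ha0 : 0 < a) (ha1 : a < 1)
    (μ : ℝ) (hμ : μ = (1 - a) / (1 + a)) (w : ℝ) (hw : |w| < μ) :
    ∑' n : ℕ, hermiteNormSq a n * w ^ n
      = (Real.sqrt (1 - a))⁻¹ * (Real.sqrt (1 - w))⁻¹ * (Real.sqrt (1 - w / μ))⁻¹ := by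
  have h := main' ha0 ha1 hμ hw
  have h2 : μ < 1 := by rw [hμ, div_lt_one (by linarith)]; linarith
  have hw1 := (abs_lt.1 hw).2
  have e : (1 - w) * (1 - a - (1 + a) * w) = (1 - a) * (1 - w) * (1 - w / μ) := by
    have h1 : 1 - a ≠ 0 := by linarith
    have h2 : 1 + a ≠ 0 := by linarith
    rw [hμ]; field_simp
  rw [e, sqrt_mul (mul_nonneg (by linarith) (by linarith)), sqrt_mul (by linarith)] at h
  rw [eq_inv_of_mul_eq_one_right h, mul_inv, mul_inv]
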